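/- arXiv:1308.0478 — 3 statements merged into one kernel-verified Lean document; each statement's English description precedes it below -/
import Mathlib

section
/- Let R be a commutative ring, let m, n be natural numbers, let g : R^m → R^n be an R-linear map that splits, and let S be any R-module. Then the R-linear map Im(g) ⊗_R S → R^n ⊗_R S induced by the inclusion Im(g) ↪ R^n (i.e. the tensor product of the inclusion with the identity of S) is injective, and its image equals the image of g ⊗ id_S : R^m ⊗_R S → R^n ⊗_R S. Consequently it induces an R-linear isomorphism Im(g) ⊗_R S ≅ Im(g ⊗ id_S). -/
open TensorProduct

/-- An `R`-linear map splits if its kernel admits a complementary submodule in the domain and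
its image (range) admits a complementary submodule in the codomain. -/
def LinearMap.Splits {R M N : Type*} [CommRing R] [AddCommGroup M] [Module R M]
    [AddCommGroup N] [Module R N] (g : M →ₗ[R] N) : Prop :=
  (∃ K' : Submodule R M, IsCompl (LinearMap.ker g) K') ∧
    (∃ I' : Submodule R N, IsCompl (LinearMap.range g) I')

/-- if `g : R^m → R^n` splits, then for any `R`-module `S` the map
`Im(g) ⊗ S → R^n ⊗ S` induced by the inclusion is injective with image equal to the image of
`g ⊗ id_S`; consequently `Im(g) ⊗ S ≅ Im(g ⊗ id_S)`. -/
theorem image_tensor_of_splits {R : Type*} [CommRing R] (m n : ℕ)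
    (g : ((Fin m → R) →ₗ[R] (Fin n → R))) (hg : g.Splits)
    (S : Type*) [AddCommGroup S] [Module R S] :
    Function.Injective (LinearMap.rTensor S (LinearMap.range g).subtype) ∧
      LinearMap.range (LinearMap.rTensor S (LinearMap.range g).subtype) =
        LinearMap.range (LinearMap.rTensor S g) ∧
      Nonempty ((↥(LinearMap.range g) ⊗[R] S) ≃ₗ[R]
        ↥(LinearMap.range (LinearMap.rTensor S g))) := by
  obtain ⟨-, I', hI⟩ := hg
  have hinj : Function.Injective (LinearMap.rTensor S (LinearMap.range g).subtype) := by
    obtain ⟨p, hp⟩ := (⟨_, Submodule.projectionOnto_apply_left hI⟩ :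
      ∃ p : (Fin n → R) →ₗ[R] LinearMap.range g, ∀ x : LinearMap.range g, p x = x)
    have h : p ∘ₗ (LinearMap.range g).subtype = LinearMap.id := by
      ext x : 1
      exact hp x
    apply Function.LeftInverse.injective (g := LinearMap.rTensor S p)
    intro x
    rw [← LinearMap.comp_apply, ← LinearMap.rTensor_comp, h, LinearMap.rTensor_id,
      LinearMap.id_apply]
  have hrange := (LinearMap.rTensor_range S (g := g)).symm
  exact ⟨hinj, hrange, ⟨(LinearEquiv.ofInjective _ hinj).trans (LinearEquiv.ofEq _ _ hrange)⟩⟩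
end

section
/- Let R be a commutative ring, let l, m, n be natural numbers, and let f : R^l → R^m and g : R^m → R^n be R-linear maps, each of which splits, with g ∘ f = 0 (so that Im(f) ⊆ Ker(g), and also Im(f ⊗ id_S) ⊆ Ker(g ⊗ id_S) for every R-module S). Let f̃ : R^l → Ker(g) denote the corestriction of f to Ker(g). Then for every R-module S, the R-linear map φ : Ker(g) ⊗_R S → Ker(g ⊗ id_S)/Im(f ⊗ id_S), obtained by composing the map induced by the inclusion Ker(g) ↪ R^m (which takes values in Ker(g ⊗ id_S) and is injective) with the quotient projection, is surjective, and its kernel equals the image of f̃ ⊗ id_S : R^l ⊗_R S → Ker(g) ⊗_R S. Consequently φ induces an R-linear isomorphism (Ker(g)/Im(f̃)) ⊗_R S ≅ Ker(g ⊗ id_S)/Im(f ⊗ id_S). -/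
open TensorProduct

set_option maxHeartbeats 4000000
set_option synthInstance.maxHeartbeats 400000

/-- The corestriction `f̃ : R^l → Ker(g)` of `f` when `g ∘ f = 0`. -/
noncomputable def corestrictToKer {R : Type*} [CommRing R] {l m n : ℕ}
    (f : (Fin l → R) →ₗ[R] (Fin m → R)) (g : (Fin m → R) →ₗ[R] (Fin n → R))
    (hgf : g ∘ₗ f = 0) : (Fin l → R) →ₗ[R] ↥(LinearMap.ker g) :=
  LinearMap.codRestrict (LinearMap.ker g) f fun x =>
    LinearMap.mem_ker.mpr (by simpa using LinearMap.congr_fun hgf x)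

/-- The map `Ker(g) ⊗ S → Ker(g ⊗ id_S)` induced by the inclusion `Ker(g) ↪ R^m`. -/
noncomputable def kerTensorToKerOfTensor {R : Type*} [CommRing R] {m n : ℕ}
    (g : (Fin m → R) →ₗ[R] (Fin n → R)) (S : Type*) [AddCommGroup S] [Module R S] :
    (↥(LinearMap.ker g) ⊗[R] S) →ₗ[R] ↥(LinearMap.ker (LinearMap.rTensor S g)) :=
  LinearMap.codRestrict (LinearMap.ker (LinearMap.rTensor S g))
    (LinearMap.rTensor S (LinearMap.ker g).subtype) fun x =>
    LinearMap.mem_ker.mpr (by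
      have h : g ∘ₗ (LinearMap.ker g).subtype = 0 := LinearMap.ext fun y => y.2
      rw [← LinearMap.comp_apply, ← LinearMap.rTensor_comp, h, LinearMap.rTensor_zero,
        LinearMap.zero_apply])

/-- The image of `f ⊗ id_S` regarded as a submodule of `Ker(g ⊗ id_S)`. -/
noncomputable def imageInKerOfTensor {R : Type*} [CommRing R] {l m n : ℕ}
    (f : (Fin l → R) →ₗ[R] (Fin m → R)) (g : (Fin m → R) →ₗ[R] (Fin n → R))
    (S : Type*) [AddCommGroup S] [Module R S] :
    Submodule R ↥(LinearMap.ker (LinearMap.rTensor S g)) :=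
  Submodule.comap (LinearMap.ker (LinearMap.rTensor S g)).subtype
    (LinearMap.range (LinearMap.rTensor S f))

/-- The quotient `Ker(g ⊗ id_S) / Im(f ⊗ id_S)`. -/
noncomputable abbrev kerOfTensorModImage {R : Type*} [CommRing R] {l m n : ℕ}
    (f : (Fin l → R) →ₗ[R] (Fin m → R)) (g : (Fin m → R) →ₗ[R] (Fin n → R))
    (S : Type*) [AddCommGroup S] [Module R S] : Type _ :=
  @HasQuotient.Quotient _ _
    (@Submodule.hasQuotient R (↥(LinearMap.ker (LinearMap.rTensor S g))) _
      (LinearMap.ker (LinearMap.rTensor S g)).addCommGroup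
      (LinearMap.ker (LinearMap.rTensor S g)).module)
    (imageInKerOfTensor f g S)

/-- The map `φ : Ker(g) ⊗ S → Ker(g ⊗ id_S)/Im(f ⊗ id_S)`: the map induced by the inclusion
`Ker(g) ↪ R^m` (with values in `Ker(g ⊗ id_S)`) followed by the quotient projection. -/
noncomputable def phiMap {R : Type*} [CommRing R] {l m n : ℕ}
    (f : (Fin l → R) →ₗ[R] (Fin m → R)) (g : (Fin m → R) →ₗ[R] (Fin n → R))
    (S : Type*) [AddCommGroup S] [Module R S] :
    (↥(LinearMap.ker g) ⊗[R] S) →ₗ[R] kerOfTensorModImage f g S :=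
  (@Submodule.mkQ R (↥(LinearMap.ker (LinearMap.rTensor S g))) _
      (LinearMap.ker (LinearMap.rTensor S g)).addCommGroup
      (LinearMap.ker (LinearMap.rTensor S g)).module
      (imageInKerOfTensor f g S)) ∘ₗ kerTensorToKerOfTensor g S

/-- Tensoring the inclusion of a direct summand stays injective. -/
theorem rTensor_subtype_injective_of_isCompl {R M : Type*} [CommRing R] [AddCommGroup M]
    [Module R M] {p q : Submodule R M} (h : IsCompl p q)
    (S : Type*) [AddCommGroup S] [Module R S] :
    Function.Injective (LinearMap.rTensor S p.subtype) := by
  have hc : (p.projectionOnto q h) ∘ₗ p.subtype = LinearMap.id :=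
    LinearMap.ext fun x => Submodule.projectionOnto_apply_left h x
  apply Function.LeftInverse.injective (g := LinearMap.rTensor S (p.projectionOnto q h))
  intro x
  rw [← LinearMap.comp_apply, ← LinearMap.rTensor_comp, hc, LinearMap.rTensor_id]
  rfl

/-- if `f : R^l → R^m` and `g : R^m → R^n` split and `g ∘ f = 0`, then for every
`R`-module `S`, the map `φ : Ker(g) ⊗ S → Ker(g ⊗ id_S)/Im(f ⊗ id_S)` is surjective with kernel
equal to the image of `f̃ ⊗ id_S : R^l ⊗ S → Ker(g) ⊗ S`; consequently
`(Ker(g)/Im(f̃)) ⊗ S ≅ Ker(g ⊗ id_S)/Im(f ⊗ id_S)`. -/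
theorem quotient_tensor_of_splits {R : Type*} [CommRing R] {l m n : ℕ}
    (f : (Fin l → R) →ₗ[R] (Fin m → R)) (g : (Fin m → R) →ₗ[R] (Fin n → R))
    (hf : f.Splits) (hg : g.Splits) (hgf : g ∘ₗ f = 0)
    (S : Type*) [AddCommGroup S] [Module R S] :
    Function.Surjective (phiMap f g S) ∧
    LinearMap.ker (phiMap f g S) =
      LinearMap.range (LinearMap.rTensor S (corestrictToKer f g hgf)) ∧
    Nonempty
      (((↥(LinearMap.ker g) ⧸ LinearMap.range (corestrictToKer f g hgf)) ⊗[R] S) ≃ₗ[R]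
        kerOfTensorModImage f g S) := by
  have hinj : Function.Injective (LinearMap.rTensor S (LinearMap.ker g).subtype) := by
    obtain ⟨K', hK⟩ := hg.1
    exact rTensor_subtype_injective_of_isCompl hK S
  have hinjK : Function.Injective (kerTensorToKerOfTensor g S) := by
    intro x y hxy
    exact hinj (congrArg Subtype.val hxy)
  have hsurj : Function.Surjective (kerTensorToKerOfTensor g S) := by
    rintro ⟨y, hy⟩
    obtain ⟨I', hI⟩ := hg.2
    have hy' : LinearMap.rTensor S g.rangeRestrict y = 0 := by
      apply rTensor_subtype_injective_of_isCompl hI S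
      rw [map_zero, ← LinearMap.comp_apply, ← LinearMap.rTensor_comp]
      exact hy
    have hex : Function.Exact (LinearMap.ker g).subtype g.rangeRestrict := by
      rw [LinearMap.exact_iff, LinearMap.ker_rangeRestrict, Submodule.range_subtype]
    obtain ⟨x, hx⟩ := (rTensor_exact S hex g.surjective_rangeRestrict y).1 hy'
    exact ⟨x, Subtype.ext hx⟩
  have hphi : Function.Surjective (phiMap f g S) := by
    intro y
    obtain ⟨z, rfl⟩ := Submodule.Quotient.mk_surjective _ y
    obtain ⟨x, rfl⟩ := hsurj z
    exact ⟨x, rfl⟩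
  have hcomp : ∀ z, LinearMap.rTensor S (LinearMap.ker g).subtype
      (LinearMap.rTensor S (corestrictToKer f g hgf) z) = LinearMap.rTensor S f z := by
    intro z
    have h : (LinearMap.ker g).subtype ∘ₗ corestrictToKer f g hgf = f :=
      LinearMap.ext fun _ => rfl
    rw [← LinearMap.comp_apply, ← LinearMap.rTensor_comp, h]
  have hker : LinearMap.ker (phiMap f g S) =
      LinearMap.range (LinearMap.rTensor S (corestrictToKer f g hgf)) := by
    ext x
    have h1 : x ∈ LinearMap.ker (phiMap f g S) ↔
        LinearMap.rTensor S (LinearMap.ker g).subtype x ∈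
          LinearMap.range (LinearMap.rTensor S f) := by
      unfold phiMap
      have hk := @Submodule.ker_mkQ R (↥(LinearMap.ker (LinearMap.rTensor S g))) _
        (LinearMap.ker (LinearMap.rTensor S g)).addCommGroup
        (LinearMap.ker (LinearMap.rTensor S g)).module (imageInKerOfTensor f g S)
      rw [LinearMap.ker_comp, Submodule.mem_comap]
      refine (SetLike.ext_iff.1 hk (kerTensorToKerOfTensor g S x)).trans ?_
      unfold imageInKerOfTensor
      rw [Submodule.mem_comap]
      rfl
    rw [h1]
    constructor
    · rintro ⟨z, hz⟩
      exact ⟨z, hinj ((hcomp z).trans hz)⟩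
    · rintro ⟨z, rfl⟩
      exact ⟨z, (hcomp z).symm⟩
  refine ⟨hphi, hker, ⟨?_⟩⟩
  have hex : Function.Exact (corestrictToKer f g hgf)
      (LinearMap.range (corestrictToKer f g hgf)).mkQ := by
    rw [LinearMap.exact_iff, Submodule.ker_mkQ]
  exact (rTensor.equiv S hex (Submodule.mkQ_surjective _)).symm.trans
    ((Submodule.quotEquivOfEq _ _ hker.symm).trans
      ((phiMap f g S).quotKerEquivOfSurjective hphi))
end

section
/- Let R be an integral domain, let m, n be natural numbers, and let g : R^m → R^n be an R-linear map. Then there exists a nonzero element d ∈ R such that, writing A for the localization of R away from d (the localization at the powers of d) and g_A : A ⊗_R R^m → A ⊗_R R^n for the base change of g to A, the A-linear map g_A splits, i.e. Ker(g_A) admits a complementary A-submodule in A ⊗_R R^m and Im(g_A) admits a complementary A-submodule in A ⊗_R R^n; moreover d can be chosen so that, in addition, Ker(g_A) and Im(g_A) are free A-modules. -/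
open TensorProduct

/-- Torsion cokernel: a common denominator for finitely many vectors. -/
lemma exists_common_mult {R M : Type*} [CommRing R] [IsDomain R] [AddCommGroup M] [Module R M]
    (N : Submodule R M) {k : ℕ} (e : Fin k → M) (h : ∀ i, ∃ a : R, a ≠ 0 ∧ a • e i ∈ N) :
    ∃ d : R, d ≠ 0 ∧ ∀ i, d • e i ∈ N := by
  choose a ha h using h
  refine ⟨∏ i, a i, Finset.prod_ne_zero_iff.2 fun i _ => ha i, fun i => ?_⟩
  rw [← Finset.prod_erase_mul _ _ (Finset.mem_univ i), mul_smul]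
  exact N.smul_mem _ (h i)

lemma li_sum_elim {R M P I J : Type*} [CommRing R] [AddCommGroup M] [Module R M]
    [AddCommGroup P] [Module R P] (f : M →ₗ[R] P) (v : I → M) (w : J → M)
    (hv : LinearIndependent R v) (hv0 : ∀ i, f (v i) = 0) (hw : LinearIndependent R (f ∘ w)) :
    LinearIndependent R (Sum.elim v w) := by
  refine linearIndependent_sum.2 ⟨hv, hw.of_comp f, ?_⟩
  have h := Submodule.range_ker_disjoint hw
  refine (h.mono_right ?_).symm
  rw [Submodule.span_le]
  rintro _ ⟨i, rfl⟩
  exact hv0 i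

/-- every element has a nonzero multiple in `N`, from generators -/
lemma torsion_of_span {R M : Type*} [CommRing R] [IsDomain R] [AddCommGroup M] [Module R M]
    (N : Submodule R M) (s : Set M) (h : ∀ x ∈ s, ∃ a : R, a ≠ 0 ∧ a • x ∈ N) (x : M)
    (hx : x ∈ Submodule.span R s) : ∃ a : R, a ≠ 0 ∧ a • x ∈ N := by
  induction hx using Submodule.span_induction with
  | mem x hx => exact h x hx
  | zero => exact ⟨1, one_ne_zero, by simp⟩
  | add x y _ _ hx hy =>
    obtain ⟨a, ha, hx⟩ := hx
    obtain ⟨b, hb, hy⟩ := hy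
    refine ⟨a * b, mul_ne_zero ha hb, ?_⟩
    rw [smul_add]
    refine N.add_mem ?_ ?_
    · rw [mul_comm, mul_smul]; exact N.smul_mem _ hx
    · rw [mul_smul]; exact N.smul_mem _ hy
  | smul r x _ hx =>
    obtain ⟨a, ha, hx⟩ := hx
    refine ⟨a, ha, ?_⟩
    rw [smul_comm]; exact N.smul_mem _ hx

/-- extension of torsion-ness along a linear map. -/
lemma torsion_ext {R M P : Type*} [CommRing R] [IsDomain R] [AddCommGroup M] [Module R M]
    [AddCommGroup P] [Module R P] (f : M →ₗ[R] P) (S T : Submodule R M)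
    (hS : ∀ x, f x = 0 → ∃ a : R, a ≠ 0 ∧ a • x ∈ S)
    (x : M) (hT : ∃ a : R, a ≠ 0 ∧ a • f x ∈ T.map f) :
    ∃ a : R, a ≠ 0 ∧ a • x ∈ S ⊔ T := by
  obtain ⟨a, ha, t, ht, e⟩ := hT
  obtain ⟨b, hb, h⟩ := hS (a • x - t) (by simp [e])
  refine ⟨b * a, mul_ne_zero hb ha, ?_⟩
  have : (b * a) • x = b • (a • x - t) + b • t := by rw [smul_sub, mul_smul]; abel
  rw [this]
  exact Submodule.add_mem_sup h (T.smul_mem _ ht)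

lemma exists_max {R M ι : Type*} [CommRing R] [IsDomain R] [AddCommGroup M] [Module R M]
    (v : ι → M) : ∃ J : Set ι, LinearIndependent R (fun j : J => v j) ∧
      ∀ i, ∃ a : R, a ≠ 0 ∧ a • v i ∈ Submodule.span R (Set.range fun j : J => v j) := by
  obtain ⟨J, hJ, h⟩ := exists_maximal_linearIndepOn R v
  refine ⟨J, hJ, fun i => ?_⟩
  have e : Set.range (fun j : J => v j) = v '' J := by
    ext; simp
  rw [e]
  by_cases hi : i ∈ J
  · exact ⟨1, one_ne_zero, Submodule.smul_mem _ _ (Submodule.subset_span ⟨i, hi, rfl⟩)⟩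
  · exact h i hi

/-- Adapted families over the domain. -/
lemma adapted {R : Type*} [CommRing R] [IsDomain R] (m n : ℕ)
    (g : (Fin m → R) →ₗ[R] (Fin n → R)) :
    ∃ (I : Set (LinearMap.ker g)) (J : Set (Fin m)) (L : Set (Fin n))
      (v : I → (Fin m → R)) (w : J → (Fin m → R)) (u : L → (Fin n → R)) (d : R), d ≠ 0 ∧
      (∀ i, g (v i) = 0) ∧
      LinearIndependent R (Sum.elim v w) ∧ LinearIndependent R (Sum.elim (g ∘ w) u) ∧
      (∀ i, d • Pi.basisFun R (Fin m) i ∈ Submodule.span R (Set.range (Sum.elim v w))) ∧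
      (∀ i, d • Pi.basisFun R (Fin n) i ∈
        Submodule.span R (Set.range (Sum.elim (g ∘ w) u))) := by
  obtain ⟨I, hI, hI'⟩ := exists_max (R := R) (fun x : LinearMap.ker g => x)
  obtain ⟨J, hJ, hJ'⟩ := exists_max (R := R) (fun i => g (Pi.basisFun R (Fin m) i))
  obtain ⟨L, hL, hL'⟩ := exists_max (R := R)
    (fun i => (LinearMap.range g).mkQ (Pi.basisFun R (Fin n) i))
  let v : I → (Fin m → R) := fun i => (i : LinearMap.ker g)
  let w : J → (Fin m → R) := fun j => Pi.basisFun R (Fin m) j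
  let u : L → (Fin n → R) := fun j => Pi.basisFun R (Fin n) j
  have hv : LinearIndependent R v := hI.map' (LinearMap.ker g).subtype (Submodule.ker_subtype _)
  have hv0 : ∀ i, g (v i) = 0 := fun i => (i : LinearMap.ker g).2
  have t1 : ∀ i, ∃ a : R, a ≠ 0 ∧ a • Pi.basisFun R (Fin m) i ∈
      Submodule.span R (Set.range (Sum.elim v w)) := by
    intro i
    rw [Set.Sum.elim_range, Submodule.span_union]
    refine torsion_ext g _ _ ?_ _ ?_
    · intro x hx
      obtain ⟨a, ha, h⟩ := hI' ⟨x, hx⟩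
      refine ⟨a, ha, ?_⟩
      have := Submodule.mem_map_of_mem (f := (LinearMap.ker g).subtype) h
      rw [Submodule.map_span, ← Set.range_comp] at this
      exact this
    · rw [Submodule.map_span, ← Set.range_comp]
      exact hJ' i
  have t2 : ∀ i, ∃ a : R, a ≠ 0 ∧ a • Pi.basisFun R (Fin n) i ∈
      Submodule.span R (Set.range (Sum.elim (g ∘ w) u)) := by
    intro i
    rw [Set.Sum.elim_range, Submodule.span_union]
    refine torsion_ext (LinearMap.range g).mkQ _ _ ?_ _ ?_
    · intro x hx
      have hx : x ∈ LinearMap.range g := by simpa using hx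
      refine torsion_of_span _ (Set.range fun i => g (Pi.basisFun R (Fin m) i)) ?_ x ?_
      · rintro _ ⟨i, rfl⟩
        exact hJ' i
      · rw [LinearMap.range_eq_map, ← (Pi.basisFun R (Fin m)).span_eq, Submodule.map_span,
          ← Set.range_comp] at hx
        exact hx
    · rw [Submodule.map_span, ← Set.range_comp]
      exact hL' i
  obtain ⟨d₁, hd₁, h₁⟩ := exists_common_mult _ _ t1
  obtain ⟨d₂, hd₂, h₂⟩ := exists_common_mult _ _ t2
  refine ⟨I, J, L, v, w, u, d₁ * d₂, mul_ne_zero hd₁ hd₂, hv0,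
    li_sum_elim g v w hv hv0 hJ,
    li_sum_elim (LinearMap.range g).mkQ (g ∘ w) u hJ (fun i => by simp) hL, ?_, ?_⟩
  · intro i
    rw [mul_comm, mul_smul]; exact Submodule.smul_mem _ _ (h₁ i)
  · intro i
    rw [mul_smul]; exact Submodule.smul_mem _ _ (h₂ i)

lemma li_base {R M I : Type*} [CommRing R] [AddCommGroup M] [Module R M] (d : R) (v : I → M)
    (hv : LinearIndependent R v) :
    LinearIndependent (Localization.Away d)
      (fun i => (1 : Localization.Away d) ⊗ₜ[R] v i) := by
  have : IsLocalizedModule (Submonoid.powers d) (TensorProduct.mk R (Localization.Away d) M 1) :=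
    (isLocalizedModule_iff_isBaseChange (Submonoid.powers d) (Localization.Away d) _).2
      (TensorProduct.isBaseChange R M (Localization.Away d))
  exact hv.of_isLocalizedModule (Localization.Away d) (Submonoid.powers d)
    (TensorProduct.mk R (Localization.Away d) M 1)

lemma span_base {R M I : Type*} [CommRing R] [AddCommGroup M] [Module R M] (d : R) (v : I → M)
    {k : ℕ} (e : Module.Basis (Fin k) R M)
    (h : ∀ i, d • e i ∈ Submodule.span R (Set.range v)) :
    Submodule.span (Localization.Away d)
      (Set.range fun i => (1 : Localization.Away d) ⊗ₜ[R] v i) = ⊤ := by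
  rw [eq_top_iff, ← (e.baseChange (Localization.Away d)).span_eq, Submodule.span_le]
  rintro _ ⟨i, rfl⟩
  have hu : IsUnit (algebraMap R (Localization.Away d) d) :=
    IsLocalization.Away.algebraMap_isUnit d
  rw [SetLike.mem_coe, ← Submodule.smul_mem_iff_of_isUnit _ hu, algebraMap_smul]
  have h' := Submodule.mem_map_of_mem (f := TensorProduct.mk R (Localization.Away d) M 1) (h i)
  rw [Submodule.map_span, ← Set.range_comp] at h'
  have := Submodule.span_le_restrictScalars R (Localization.Away d) _ h'
  simpa [Function.comp_def] using this

lemma final {A X Y I J L : Type*} [CommRing A] [AddCommGroup X] [Module A X]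
    [AddCommGroup Y] [Module A Y] (G : X →ₗ[A] Y) (v : I → X) (w : J → X) (u : L → Y)
    (hv : ∀ i, G (v i) = 0)
    (l1 : LinearIndependent A (Sum.elim v w)) (l2 : LinearIndependent A (Sum.elim (G ∘ w) u))
    (s1 : Submodule.span A (Set.range (Sum.elim v w)) = ⊤)
    (s2 : Submodule.span A (Set.range (Sum.elim (G ∘ w) u)) = ⊤) :
    (∃ K', IsCompl (LinearMap.ker G) K') ∧ (∃ I', IsCompl (LinearMap.range G) I') ∧
      Module.Free A (LinearMap.ker G) ∧ Module.Free A (LinearMap.range G) := by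
  rw [Set.Sum.elim_range, Submodule.span_union] at s1 s2
  obtain ⟨lv, lw, dvw⟩ := linearIndependent_sum.1 l1
  obtain ⟨lgw, lu, dgu⟩ := linearIndependent_sum.1 l2
  simp only [Sum.elim_comp_inl, Sum.elim_comp_inr] at lv lw dvw lgw lu dgu
  have hle : Submodule.span A (Set.range v) ≤ LinearMap.ker G := by
    rw [Submodule.span_le]; rintro _ ⟨i, rfl⟩; exact hv i
  have hdisj := Submodule.range_ker_disjoint lgw
  have hk : LinearMap.ker G = Submodule.span A (Set.range v) := by
    refine le_antisymm (fun x hx => ?_) hle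
    obtain ⟨y, hy, z, hz, rfl⟩ := Submodule.mem_sup.1 (s1 ▸ Submodule.mem_top : x ∈ _)
    have hz' : z ∈ LinearMap.ker G := by
      have := hle hy
      simp only [LinearMap.mem_ker, map_add] at this hx ⊢
      simpa [this] using hx
    rw [Submodule.disjoint_def.1 hdisj z hz hz', add_zero]
    exact hy
  have hr : LinearMap.range G = Submodule.span A (Set.range (G ∘ w)) := by
    rw [LinearMap.range_eq_map, ← s1, Submodule.map_sup, LinearMap.le_ker_iff_map.1 hle,
      bot_sup_eq, Submodule.map_span, ← Set.range_comp]
  rw [hk, hr]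
  exact ⟨⟨_, dvw, codisjoint_iff.2 s1⟩, ⟨_, dgu, codisjoint_iff.2 s2⟩,
    Module.Free.of_basis (Module.Basis.span lv), Module.Free.of_basis (Module.Basis.span lgw)⟩

/-- over an integral domain `R`, any linear map `g : R^m → R^n` splits after
localizing away from a suitable nonzero element `d`, and `d` can moreover be chosen so that the
kernel and the image of the localized map are free modules. -/
theorem exists_localization_splits {R : Type*} [CommRing R] [IsDomain R] (m n : ℕ)
    (g : (Fin m → R) →ₗ[R] (Fin n → R)) :
    ∃ d : R, d ≠ 0 ∧
      (∃ K' : Submodule (Localization.Away d) (Localization.Away d ⊗[R] (Fin m → R)),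
        IsCompl (LinearMap.ker (LinearMap.baseChange (Localization.Away d) g)) K') ∧
      (∃ I' : Submodule (Localization.Away d) (Localization.Away d ⊗[R] (Fin n → R)),
        IsCompl (LinearMap.range (LinearMap.baseChange (Localization.Away d) g)) I') ∧
      Module.Free (Localization.Away d)
        ↥(LinearMap.ker (LinearMap.baseChange (Localization.Away d) g)) ∧
      Module.Free (Localization.Away d)
        ↥(LinearMap.range (LinearMap.baseChange (Localization.Away d) g)) := by
  obtain ⟨I, J, L, v, w, u, d, hd, hv, l1, l2, s1, s2⟩ := adapted m n g
  refine ⟨d, hd, ?_⟩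
  have e1 : (fun i => (1 : Localization.Away d) ⊗ₜ[R] Sum.elim v w i) =
      Sum.elim (fun i => (1 : Localization.Away d) ⊗ₜ[R] v i)
        (fun i => (1 : Localization.Away d) ⊗ₜ[R] w i) := by
    ext i; cases i <;> rfl
  have e2 : (fun i => (1 : Localization.Away d) ⊗ₜ[R] Sum.elim (g ∘ w) u i) =
      Sum.elim (LinearMap.baseChange (Localization.Away d) g ∘
        fun i => (1 : Localization.Away d) ⊗ₜ[R] w i)
        (fun i => (1 : Localization.Away d) ⊗ₜ[R] u i) := by
    ext i; cases i <;> rfl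
  refine final (LinearMap.baseChange (Localization.Away d) g)
    (fun i => (1 : Localization.Away d) ⊗ₜ[R] v i) (fun i => (1 : Localization.Away d) ⊗ₜ[R] w i)
    (fun i => (1 : Localization.Away d) ⊗ₜ[R] u i) (fun i => by simp [hv]) ?_ ?_ ?_ ?_
  · rw [← e1]; exact li_base d _ l1
  · rw [← e2]; exact li_base d _ l2
  · rw [← e1]; exact span_base d _ (Pi.basisFun R (Fin m)) s1
  · rw [← e2]; exact span_base d _ (Pi.basisFun R (Fin n)) s2
end
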